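/- Take a ≡ 1 and p > 2. Let u_rad ∈ C¹₀(A) be a radial weak solution of −Δu + u = |u|^{p−2}u in A with u_rad > 0 in A, and assume u_rad lies in the C¹-interior of the positive cone, i.e. there is ε₀ > 0 such that every w ∈ C¹₀(A) with ‖w − u_rad‖_{C¹} < ε₀ satisfies w ≥ 0 in A. Suppose there exists an axially symmetric v ∈ C¹₀(A), v(x) = 𝔳(r,θ), such that: (1) ∫_A (|∇v|² + v² − (p−1) u_rad^{p−2} v²) dx < 0; (2) θ ↦ 𝔳(r,θ) is nonincreasing on [0,π/2] for every r ∈ [R₀,R₁]; (3) 𝔳(r,θ) = 𝔳(r,−θ) for all (r,θ); (4) ∫_{S^{N−1}} v(rσ) dσ(σ) = 0 for every r ∈ (R₀,R₁), where dσ is the surface measure on the unit sphere S^{N−1}. Then c_I < I(u_rad); in particular u_rad is not a minimizer of I over N_K. -/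

import Mathlib

open MeasureTheory Real Set

noncomputable section

/-- The open annulus `{x : R₀ < |x| < R₁}` in `ℝ^N`. -/
def annulus (N : ℕ) (R₀ R₁ : ℝ) : Set (EuclideanSpace ℝ (Fin N)) :=
  {x | R₀ < ‖x‖ ∧ ‖x‖ < R₁}

/-- The last coordinate `x_N` of a point of `ℝ^N`. -/
def lastCoord {N : ℕ} (x : EuclideanSpace ℝ (Fin N)) : ℝ :=
  if h : 0 < N then x ⟨N - 1, by omega⟩ else 0

/-- The polar angle `θ = arcsin (x_N / |x|)`. -/
def angleOf {N : ℕ} (x : EuclideanSpace ℝ (Fin N)) : ℝ :=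
  Real.arcsin (lastCoord x / ‖x‖)

/-- `u` is axially symmetric on the closed annulus with representative `𝔲 = 𝔲(r,θ)`. -/
def IsAxiallySymmRep (N : ℕ) (R₀ R₁ : ℝ) (u : EuclideanSpace ℝ (Fin N) → ℝ)
    (𝔲 : ℝ → ℝ → ℝ) : Prop :=
  ∀ x ∈ closure (annulus N R₀ R₁), u x = 𝔲 ‖x‖ (angleOf x)

/-- Membership in the cone `K̂`: `C¹` on the closed annulus, nonnegative, axially symmetric,
even in `θ` and nonincreasing in `θ` on `[0, π/2]`. -/
def memKhat (N : ℕ) (R₀ R₁ : ℝ) (u : EuclideanSpace ℝ (Fin N) → ℝ) : Prop :=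
  ContDiffOn ℝ 1 u (closure (annulus N R₀ R₁)) ∧
  (∀ x ∈ closure (annulus N R₀ R₁), 0 ≤ u x) ∧
  ∃ 𝔲 : ℝ → ℝ → ℝ,
    IsAxiallySymmRep N R₀ R₁ u 𝔲 ∧
    (∀ r ∈ Icc R₀ R₁, ∀ θ ∈ Icc (-(π / 2)) (π / 2), 𝔲 r (-θ) = 𝔲 r θ) ∧
    (∀ r ∈ Icc R₀ R₁, AntitoneOn (𝔲 r) (Icc 0 (π / 2)))

/-- `C¹₀(A)` : `C¹` on the closed annulus, vanishing on the boundary. -/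
def memC10 (N : ℕ) (R₀ R₁ : ℝ) (u : EuclideanSpace ℝ (Fin N) → ℝ) : Prop :=
  ContDiffOn ℝ 1 u (closure (annulus N R₀ R₁)) ∧
  ∀ x : EuclideanSpace ℝ (Fin N), (‖x‖ = R₀ ∨ ‖x‖ = R₁) → u x = 0

/-- The cone `K = K̂ ∩ C¹₀(A)`. -/
def memK (N : ℕ) (R₀ R₁ : ℝ) (u : EuclideanSpace ℝ (Fin N) → ℝ) : Prop :=
  memKhat N R₀ R₁ u ∧ ∀ x : EuclideanSpace ℝ (Fin N), (‖x‖ = R₀ ∨ ‖x‖ = R₁) → u x = 0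

/-- The squared `H¹(A)`-norm `∫_A (|∇u|² + u²) dx`. -/
def H1sq (N : ℕ) (R₀ R₁ : ℝ) (u : EuclideanSpace ℝ (Fin N) → ℝ) : ℝ :=
  ∫ x in annulus N R₀ R₁,
    (‖fderivWithin ℝ u (closure (annulus N R₀ R₁)) x‖ ^ 2 + (u x) ^ 2)

/-- The energy functional `I(u) = ½‖u‖²_{H¹} − (1/p) ∫_A a |u|^p`. -/
def funcI (N : ℕ) (R₀ R₁ : ℝ) (a : EuclideanSpace ℝ (Fin N) → ℝ) (p : ℝ)
    (u : EuclideanSpace ℝ (Fin N) → ℝ) : ℝ :=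
  (1 / 2) * H1sq N R₀ R₁ u - (1 / p) * ∫ x in annulus N R₀ R₁, a x * |u x| ^ p

/-- The Nehari set `N_K`. -/
def memNehari (N : ℕ) (R₀ R₁ : ℝ) (a : EuclideanSpace ℝ (Fin N) → ℝ) (p : ℝ)
    (u : EuclideanSpace ℝ (Fin N) → ℝ) : Prop :=
  memK N R₀ R₁ u ∧ (∃ x ∈ annulus N R₀ R₁, u x ≠ 0) ∧
  H1sq N R₀ R₁ u = ∫ x in annulus N R₀ R₁, a x * |u x| ^ p

/-- The Nehari level `c_I = inf_{N_K} I`. -/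
def cI (N : ℕ) (R₀ R₁ : ℝ) (a : EuclideanSpace ℝ (Fin N) → ℝ) (p : ℝ) : ℝ :=
  sInf {c | ∃ u, memNehari N R₀ R₁ a p u ∧ c = funcI N R₀ R₁ a p u}

/-- Test functions `C_c^∞(A)`. -/
def IsTestFun (N : ℕ) (R₀ R₁ : ℝ) (φ : EuclideanSpace ℝ (Fin N) → ℝ) : Prop :=
  ContDiff ℝ (⊤ : ℕ∞) φ ∧ HasCompactSupport φ ∧ tsupport φ ⊆ annulus N R₀ R₁

/-- Weak solution of `−Δu + u = a(x)|u|^{p−2}u` in `A`, `u = 0` on `∂A`. -/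
def IsWeakSolution (N : ℕ) (R₀ R₁ : ℝ) (a : EuclideanSpace ℝ (Fin N) → ℝ) (p : ℝ)
    (u : EuclideanSpace ℝ (Fin N) → ℝ) : Prop :=
  memC10 N R₀ R₁ u ∧
  ∀ φ : EuclideanSpace ℝ (Fin N) → ℝ, IsTestFun N R₀ R₁ φ →
    (∫ x in annulus N R₀ R₁,
      (fderivWithin ℝ u (closure (annulus N R₀ R₁)) x (gradient φ x) + u x * φ x))
    = ∫ x in annulus N R₀ R₁, a x * |u x| ^ (p - 2) * u x * φ x

/-- The (classical) Laplacian, as the sum of second partial derivatives. -/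
def lapl {N : ℕ} (u : EuclideanSpace ℝ (Fin N) → ℝ) (x : EuclideanSpace ℝ (Fin N)) : ℝ :=
  ∑ i : Fin N,
    fderiv ℝ (fun y => fderiv ℝ u y (EuclideanSpace.single i 1)) x (EuclideanSpace.single i 1)

/-- The inclusion `ℝ^{N-1} → ℝ^N`, `x' ↦ (x',0)`. -/
def embedHyper (N : ℕ) (x' : EuclideanSpace ℝ (Fin (N - 1))) : EuclideanSpace ℝ (Fin N) :=
  (WithLp.equiv 2 (Fin N → ℝ)).symm
    (fun j => if h : (j : ℕ) < N - 1 then x' ⟨j, h⟩ else 0)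

/-- A `C¹` distance on the closed annulus. -/
def C1dist (N : ℕ) (R₀ R₁ : ℝ) (u v : EuclideanSpace ℝ (Fin N) → ℝ) : ℝ :=
  (⨆ x : closure (annulus N R₀ R₁), |u x - v x|) +
  (⨆ x : closure (annulus N R₀ R₁),
    ‖fderivWithin ℝ u (closure (annulus N R₀ R₁)) x
      - fderivWithin ℝ v (closure (annulus N R₀ R₁)) x‖)

end


section Aux
open Filter Topology

variable {N : ℕ} {R₀ R₁ : ℝ}

local notation "EE" => EuclideanSpace ℝ (Fin N)

lemma annulus_isOpen : IsOpen (annulus N R₀ R₁) := by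
  have : annulus N R₀ R₁ = (fun x : EE => ‖x‖) ⁻¹' (Ioo R₀ R₁) := by
    ext x; simp [annulus]
  rw [this]
  exact isOpen_Ioo.preimage continuous_norm

lemma annulus_ball (h0 : 0 < R₀) (h1 : R₀ < R₁) {x : EE} (hx : R₀ ≤ ‖x‖) (hx' : ‖x‖ ≤ R₁) :
    ∃ c : EE, ∃ ρ : ℝ, 0 < ρ ∧ x ∈ Metric.closedBall c ρ ∧ Metric.ball c ρ ⊆ annulus N R₀ R₁ := by
  have hxp : 0 < ‖x‖ := h0.trans_le hx
  refine ⟨(((R₀ + R₁) / 2) / ‖x‖) • x, (R₁ - R₀) / 2, by linarith, ?_, ?_⟩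
  · rw [Metric.mem_closedBall, dist_eq_norm]
    have : x - (((R₀ + R₁) / 2) / ‖x‖) • x = (1 - ((R₀ + R₁) / 2) / ‖x‖) • x := by
      rw [sub_smul, one_smul]
    rw [this, norm_smul, Real.norm_eq_abs]
    have : |1 - (R₀ + R₁) / 2 / ‖x‖| * ‖x‖ = |‖x‖ - (R₀ + R₁) / 2| := by
      rw [← abs_of_pos hxp, ← abs_mul, abs_of_pos hxp]
      congr 1
      field_simp
    rw [this, abs_le]
    constructor <;> linarith
  · intro y hy
    rw [Metric.mem_ball, dist_eq_norm] at hy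
    have hc : ‖(((R₀ + R₁) / 2) / ‖x‖) • x‖ = (R₀ + R₁) / 2 := by
      rw [norm_smul, Real.norm_eq_abs, abs_of_pos (div_pos (by linarith) hxp)]
      field_simp
    have a1 := norm_sub_norm_le y ((((R₀ + R₁) / 2) / ‖x‖) • x)
    have a2 := norm_sub_norm_le ((((R₀ + R₁) / 2) / ‖x‖) • x) y
    rw [norm_sub_rev] at a2
    rw [hc] at a1 a2
    constructor <;> linarith

lemma closure_annulus (h0 : 0 < R₀) (h1 : R₀ < R₁) :
    closure (annulus N R₀ R₁) = {x : EE | R₀ ≤ ‖x‖ ∧ ‖x‖ ≤ R₁} := by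
  apply Subset.antisymm
  · apply closure_minimal
    · intro x hx; exact ⟨hx.1.le, hx.2.le⟩
    · exact (isClosed_le continuous_const continuous_norm).inter
        (isClosed_le continuous_norm continuous_const)
  · rintro x ⟨hx, hx'⟩
    obtain ⟨c, ρ, hρ, hxc, hs⟩ := annulus_ball h0 h1 hx hx'
    rw [← closure_ball c hρ.ne'] at hxc
    exact closure_mono hs hxc

lemma uniqueDiff_annulus (h0 : 0 < R₀) (h1 : R₀ < R₁) :
    UniqueDiffOn ℝ (closure (annulus N R₀ R₁)) := by
  intro x hx
  have hx2 := hx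
  rw [closure_annulus h0 h1] at hx2
  obtain ⟨c, ρ, hρ, hxc, hs⟩ := annulus_ball h0 h1 hx2.1 hx2.2
  have hs2 : Metric.closedBall c ρ ⊆ closure (annulus N R₀ R₁) := by
    rw [← closure_ball c hρ.ne']; exact closure_mono hs
  refine UniqueDiffWithinAt.mono ?_ hs2
  refine (uniqueDiffOn_convex (convex_closedBall c ρ) ?_) x hxc
  exact ⟨c, Metric.ball_subset_interior_closedBall (Metric.mem_ball_self hρ)⟩

lemma isCompact_cl (h0 : 0 < R₀) (h1 : R₀ < R₁) : IsCompact (closure (annulus N R₀ R₁)) := by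
  refine Metric.isCompact_of_isClosed_isBounded isClosed_closure ?_
  refine (Metric.isBounded_closedBall (x := (0 : EE)) (r := R₁)).subset ?_
  rw [closure_annulus h0 h1]
  intro x hx
  simpa using hx.2

lemma finite_restrict (h0 : 0 < R₀) (h1 : R₀ < R₁) :
    IsFiniteMeasure ((volume : Measure EE).restrict (annulus N R₀ R₁)) := by
  refine ⟨?_⟩
  rw [Measure.restrict_apply_univ]
  exact (measure_mono subset_closure).trans_lt (isCompact_cl h0 h1).measure_lt_top

/-- continuous on the closed annulus implies integrable on the annulus -/
lemma integrable_of_cont (h0 : 0 < R₀) (h1 : R₀ < R₁) {f : EE → ℝ}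
    (hf : ContinuousOn f (closure (annulus N R₀ R₁))) :
    Integrable f ((volume : Measure EE).restrict (annulus N R₀ R₁)) :=
  (hf.integrableOn_compact (isCompact_cl h0 h1)).mono_set subset_closure

lemma cont_fd (h0 : 0 < R₀) (h1 : R₀ < R₁) {f : EE → ℝ}
    (hf : ContDiffOn ℝ 1 f (closure (annulus N R₀ R₁))) :
    ContinuousOn (fun x => fderivWithin ℝ f (closure (annulus N R₀ R₁)) x)
      (closure (annulus N R₀ R₁)) :=
  hf.continuousOn_fderivWithin (uniqueDiff_annulus h0 h1) le_rfl

lemma fdW_eq {f : EE → ℝ} {x : EE} (hx : x ∈ annulus N R₀ R₁) :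
    fderivWithin ℝ f (closure (annulus N R₀ R₁)) x = fderiv ℝ f x :=
  fderivWithin_of_mem_nhds (mem_of_superset (annulus_isOpen.mem_nhds hx) subset_closure)

/-- the gradient of `f` on the closed annulus, as a vector field -/
noncomputable def gW (N : ℕ) (R₀ R₁ : ℝ) (f : EuclideanSpace ℝ (Fin N) → ℝ) (x : EuclideanSpace ℝ (Fin N)) :
    EuclideanSpace ℝ (Fin N) :=
  (InnerProductSpace.toDual ℝ (EuclideanSpace ℝ (Fin N))).symm
    (fderivWithin ℝ f (closure (annulus N R₀ R₁)) x)

lemma norm_gW (f : EE → ℝ) (x : EE) :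
    ‖gW N R₀ R₁ f x‖ = ‖fderivWithin ℝ f (closure (annulus N R₀ R₁)) x‖ := by
  simp [gW]

lemma inner_gW (f : EE → ℝ) (x y : EE) :
    fderivWithin ℝ f (closure (annulus N R₀ R₁)) x y = inner ℝ (gW N R₀ R₁ f x) y := by
  simp [gW]

lemma cont_gW (h0 : 0 < R₀) (h1 : R₀ < R₁) {f : EE → ℝ}
    (hf : ContDiffOn ℝ 1 f (closure (annulus N R₀ R₁))) :
    ContinuousOn (gW N R₀ R₁ f) (closure (annulus N R₀ R₁)) :=
  (LinearIsometryEquiv.continuous _).comp_continuousOn (cont_fd h0 h1 hf)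

lemma gW_add_smul (h0 : 0 < R₀) (h1 : R₀ < R₁) {f g : EE → ℝ} (a b : ℝ)
    (hf : ContDiffOn ℝ 1 f (closure (annulus N R₀ R₁)))
    (hg : ContDiffOn ℝ 1 g (closure (annulus N R₀ R₁))) {x : EE}
    (hx : x ∈ closure (annulus N R₀ R₁)) :
    gW N R₀ R₁ (fun y => a * f y + b * g y) x = a • gW N R₀ R₁ f x + b • gW N R₀ R₁ g x := by
  have hu := uniqueDiff_annulus h0 h1 x hx
  have hf' := (hf.differentiableOn one_ne_zero x hx).hasFDerivWithinAt
  have hg' := (hg.differentiableOn one_ne_zero x hx).hasFDerivWithinAt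
  have := ((hf'.const_mul a).add (hg'.const_mul b)).fderivWithin hu
  unfold gW
  have h2 : fderivWithin ℝ (fun y => a * f y + b * g y) (closure (annulus N R₀ R₁)) x = _ := this
  rw [h2]
  simp

/-- the weak identity, for a function `g` with gradient field `G` -/
def WI (N : ℕ) (R₀ R₁ p : ℝ) (u : EuclideanSpace ℝ (Fin N) → ℝ)
    (g : EuclideanSpace ℝ (Fin N) → ℝ) (G : EuclideanSpace ℝ (Fin N) → EuclideanSpace ℝ (Fin N)) :
    Prop :=
  (∫ x in annulus N R₀ R₁, (inner ℝ (gW N R₀ R₁ u x) (G x) + u x * g x))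
    = ∫ x in annulus N R₀ R₁, |u x| ^ (p - 2) * u x * g x

lemma cont_pow {p : ℝ} (hp : 2 < p) {S : Set EE} {u : EE → ℝ} (hu : ContinuousOn u S) :
    ContinuousOn (fun x => |u x| ^ (p - 2) * u x) S :=
  (hu.abs.rpow_const (fun x _ => Or.inr (by linarith))).mul hu

/-- stability of the weak identity under bounded pointwise limits -/
lemma WI_lim (h0 : 0 < R₀) (h1 : R₀ < R₁) {p : ℝ} (hp : 2 < p) {u : EE → ℝ}
    (hu : ContDiffOn ℝ 1 u (closure (annulus N R₀ R₁)))
    {g : EE → ℝ} {G : EE → EE} {gn : ℕ → EE → ℝ} {Gn : ℕ → EE → EE} {C : ℝ}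
    (hn : ∀ n, WI N R₀ R₁ p u (gn n) (Gn n))
    (hc : ∀ n, ContinuousOn (gn n) (annulus N R₀ R₁))
    (hC : ∀ n, ContinuousOn (Gn n) (annulus N R₀ R₁))
    (hb : ∀ n, ∀ x ∈ annulus N R₀ R₁, |gn n x| ≤ C)
    (hB : ∀ n, ∀ x ∈ annulus N R₀ R₁, ‖Gn n x‖ ≤ C)
    (ht : ∀ x ∈ annulus N R₀ R₁, Tendsto (fun n => gn n x) atTop (𝓝 (g x)))
    (hT : ∀ x ∈ annulus N R₀ R₁, Tendsto (fun n => Gn n x) atTop (𝓝 (G x))) :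
    WI N R₀ R₁ p u g G := by
  have := finite_restrict (N := N) h0 h1
  have hcu := hu.continuousOn
  have hcg := cont_gW h0 h1 hu
  have hcp := cont_pow hp hcu
  have hsub : annulus N R₀ R₁ ⊆ closure (annulus N R₀ R₁) := subset_closure
  have hm : MeasurableSet (annulus N R₀ R₁) := annulus_isOpen.measurableSet
  obtain ⟨M1, hM1⟩ := (isCompact_cl (N := N) h0 h1).exists_bound_of_continuousOn hcu
  obtain ⟨M2, hM2⟩ := (isCompact_cl (N := N) h0 h1).exists_bound_of_continuousOn hcg
  obtain ⟨M3, hM3⟩ := (isCompact_cl (N := N) h0 h1).exists_bound_of_continuousOn hcp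
  have L := tendsto_integral_of_dominated_convergence
    (μ := volume.restrict (annulus N R₀ R₁))
    (F := fun n x => inner ℝ (gW N R₀ R₁ u x) (Gn n x) + u x * gn n x)
    (f := fun x => inner ℝ (gW N R₀ R₁ u x) (G x) + u x * g x)
    (fun _ => M2 * C + M1 * C) ?_ (integrable_const _) ?_ ?_
  · have Rr := tendsto_integral_of_dominated_convergence
      (μ := volume.restrict (annulus N R₀ R₁))
      (F := fun n x => |u x| ^ (p - 2) * u x * gn n x)
      (f := fun x => |u x| ^ (p - 2) * u x * g x)
      (fun _ => M3 * C) ?_ (integrable_const _) ?_ ?_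
    · have e : (fun n => ∫ x in annulus N R₀ R₁,
          (inner ℝ (gW N R₀ R₁ u x) (Gn n x) + u x * gn n x)) =
          fun n => ∫ x in annulus N R₀ R₁, |u x| ^ (p - 2) * u x * gn n x := funext hn
      rw [e] at L
      exact tendsto_nhds_unique L Rr
    · intro n
      exact ((hcp.mono hsub).mul (hc n)).aestronglyMeasurable hm
    · intro n
      refine (ae_restrict_iff' hm).2 (Eventually.of_forall fun x hx => ?_)
      rw [norm_mul]
      exact mul_le_mul (hM3 x (hsub hx)) (hb n x hx) (norm_nonneg _)
        ((norm_nonneg _).trans (hM3 x (hsub hx)))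
    · refine (ae_restrict_iff' hm).2 (Eventually.of_forall fun x hx => ?_)
      exact (ht x hx).const_mul _
  · intro n
    exact (((hcg.mono hsub).inner (hC n)).add ((hcu.mono hsub).mul (hc n))).aestronglyMeasurable hm
  · intro n
    refine (ae_restrict_iff' hm).2 (Eventually.of_forall fun x hx => ?_)
    refine (norm_add_le _ _).trans (add_le_add ?_ ?_)
    · exact (norm_inner_le_norm _ _).trans (mul_le_mul (hM2 x (hsub hx)) (hB n x hx) (norm_nonneg _)
        ((norm_nonneg _).trans (hM2 x (hsub hx))))
    · rw [norm_mul]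
      exact mul_le_mul (hM1 x (hsub hx)) (hb n x hx) (norm_nonneg _)
        ((norm_nonneg _).trans (hM1 x (hsub hx)))
  · refine (ae_restrict_iff' hm).2 (Eventually.of_forall fun x hx => ?_)
    exact (tendsto_const_nhds.inner (hT x hx)).add ((ht x hx).const_mul _)

open scoped Convolution in
/-- mollification of a compactly supported `C¹` function -/
lemma WI_C1c (h0 : 0 < R₀) (h1 : R₀ < R₁) {p : ℝ} (hp : 2 < p) {u : EE → ℝ}
    (hsol : IsWeakSolution N R₀ R₁ (fun _ => 1) p u) {ψ : EE → ℝ} (hψ : ContDiff ℝ 1 ψ)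
    (hcs : HasCompactSupport ψ) (hts : tsupport ψ ⊆ annulus N R₀ R₁) :
    WI N R₀ R₁ p u ψ (gradient ψ) := by
  obtain ⟨δ, hδ, hsub⟩ := IsCompact.exists_cthickening_subset_open hcs annulus_isOpen hts
  let φ : ℕ → ContDiffBump (0 : EE) := fun n =>
    ⟨δ / (n + 1) / 2, δ / (n + 1), by positivity, half_lt_self (by positivity)⟩
  have hφ : Tendsto (fun i => (φ i).rOut) atTop (𝓝 0) :=
    tendsto_const_div_atTop_nhds_zero_nat (𝕜 := ℝ) δ |>.comp (tendsto_add_atTop_nat 1) |>.congr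
      (fun n => by simp [φ])
  have hφδ : ∀ n, (φ n).rOut ≤ δ := fun n => by
    simp only [φ]
    exact div_le_self hδ.le (by linarith [(Nat.cast_nonneg n : (0 : ℝ) ≤ n)])
  let f : ℕ → EE → ℝ := fun n => (φ n).normed volume ⋆[ContinuousLinearMap.lsmul ℝ ℝ, volume] ψ
  have hψc := hψ.continuous
  have hDc : Continuous (fderiv ℝ ψ) := hψ.continuous_fderiv one_ne_zero
  have hfd : ∀ n x, HasFDerivAt (f n)
      (((φ n).normed volume ⋆[ContinuousLinearMap.lsmul ℝ ℝ, volume] (fderiv ℝ ψ)) x) x := by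
    intro n x
    have := hcs.hasFDerivAt_convolution_right (ContinuousLinearMap.lsmul ℝ ℝ) (μ := volume)
      (((φ n).continuous_normed (μ := volume)).locallyIntegrable) hψ x
    have hL : (ContinuousLinearMap.lsmul ℝ ℝ : ℝ →L[ℝ] ℝ →L[ℝ] ℝ).precompR EE
        = ContinuousLinearMap.lsmul ℝ ℝ := by
      ext a g; simp [ContinuousLinearMap.precompR]
    rw [hL] at this
    exact this
  have hfs : ∀ n, ContDiff ℝ (⊤ : ℕ∞) (f n) := fun n =>
    (φ n).hasCompactSupport_normed.contDiff_convolution_left _ (φ n).contDiff_normed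
      hψc.locallyIntegrable
  have hfsup : ∀ n, Function.support (f n) ⊆ Metric.cthickening δ (tsupport ψ) := by
    intro n x hx
    obtain ⟨a, ha, b, hb, rfl⟩ := support_convolution_subset _ hx
    rw [(φ n).support_normed_eq] at ha
    refine Metric.mem_cthickening_of_dist_le (a + b) b δ _ (subset_tsupport _ hb) ?_
    rw [Metric.mem_ball, dist_zero_right] at ha
    simpa [dist_eq_norm] using ha.le.trans (hφδ n)
  have htsup : ∀ n, tsupport (f n) ⊆ Metric.cthickening δ (tsupport ψ) := fun n =>
    closure_minimal (hfsup n) Metric.isClosed_cthickening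
  have hcomp : IsCompact (Metric.cthickening δ (tsupport ψ)) := IsCompact.cthickening hcs
  have htest : ∀ n, IsTestFun N R₀ R₁ (f n) := fun n =>
    ⟨hfs n, hcomp.of_isClosed_subset (isClosed_tsupport _) (htsup n), (htsup n).trans hsub⟩
  obtain ⟨M1, hM1⟩ := hcs.exists_bound_of_continuous hψc
  obtain ⟨M2, hM2⟩ := (hcs.fderiv ℝ).exists_bound_of_continuous hDc
  have hM1' : 0 ≤ M1 := (norm_nonneg _).trans (hM1 0)
  have hM2' : 0 ≤ M2 := (norm_nonneg _).trans (hM2 0)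
  have hgrad : ∀ n x, gradient (f n) x = (InnerProductSpace.toDual ℝ EE).symm
      (((φ n).normed volume ⋆[ContinuousLinearMap.lsmul ℝ ℝ, volume] (fderiv ℝ ψ)) x) := by
    intro n x
    rw [gradient, (hfd n x).fderiv]
  refine WI_lim h0 h1 hp hsol.1.1 (gn := f) (Gn := fun n => gradient (f n))
    (C := 3 * M1 + 3 * M2) ?_ ?_ ?_ ?_ ?_ ?_ ?_
  · intro n
    have := hsol.2 (f n) (htest n)
    unfold WI
    simpa only [inner_gW, one_mul] using this
  · intro n
    exact (hfs n).continuous.continuousOn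
  · intro n
    have : Continuous (fderiv ℝ (f n)) := (hfs n).continuous_fderiv (by simp)
    exact ((LinearIsometryEquiv.continuous _).comp this).continuousOn
  · intro n x _
    have := (φ n).dist_normed_convolution_le (x₀ := x) (ε := 2 * M1) (μ := volume) (g := ψ)
      hψc.aestronglyMeasurable
      (fun y _ => (dist_le_norm_add_norm _ _).trans (by linarith [hM1 y, hM1 x]))
    have h3 : ‖f n x‖ ≤ ‖f n x - ψ x‖ + ‖ψ x‖ := by
      simpa using norm_add_le (f n x - ψ x) (ψ x)
    rw [dist_eq_norm] at this
    rw [← Real.norm_eq_abs]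
    linarith [hM1 x]
  · intro n x _
    rw [hgrad, LinearIsometryEquiv.norm_map]
    have := (φ n).dist_normed_convolution_le (x₀ := x) (ε := 2 * M2) (μ := volume) (g := fderiv ℝ ψ)
      hDc.aestronglyMeasurable
      (fun y _ => (dist_le_norm_add_norm _ _).trans (by linarith [hM2 y, hM2 x]))
    rw [dist_eq_norm] at this
    have h3 := norm_add_le (((φ n).normed volume ⋆[ContinuousLinearMap.lsmul ℝ ℝ, volume]
      (fderiv ℝ ψ)) x - fderiv ℝ ψ x) (fderiv ℝ ψ x)
    rw [sub_add_cancel] at h3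
    linarith [hM2 x]
  · intro x _
    exact ContDiffBump.convolution_tendsto_right_of_continuous hφ hψc x
  · intro x _
    simp_rw [hgrad]
    exact ((LinearIsometryEquiv.continuous _).tendsto _).comp
      (ContDiffBump.convolution_tendsto_right_of_continuous hφ hDc x)

/-- clamp function -/
noncomputable def clampF (n : ℕ) (t : ℝ) : ℝ := max 0 (min 1 (((n : ℝ) + 1) * t - 1))

/-- truncation -/
noncomputable def truncF (n : ℕ) (t : ℝ) : ℝ := ∫ s in (0 : ℝ)..t, clampF n s

lemma clampF_cont (n : ℕ) : Continuous (clampF n) := by unfold clampF; fun_prop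

lemma clampF_nonneg (n : ℕ) (t : ℝ) : 0 ≤ clampF n t := le_max_left _ _

lemma clampF_le (n : ℕ) (t : ℝ) : clampF n t ≤ 1 := max_le zero_le_one (min_le_left _ _)

lemma clampF_tendsto {t : ℝ} (ht : 0 < t) : Tendsto (fun n => clampF n t) atTop (𝓝 1) := by
  refine tendsto_const_nhds.congr' ?_
  obtain ⟨k, hk⟩ := exists_nat_gt (2 / t)
  filter_upwards [eventually_ge_atTop k] with n hn
  have h2 : (2 : ℝ) / t < n := hk.trans_le (by exact_mod_cast hn)
  rw [div_lt_iff₀ ht] at h2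
  unfold clampF
  rw [min_eq_left (by nlinarith), max_eq_right zero_le_one]

lemma clampF_zero {n : ℕ} {t : ℝ} (ht : t ≤ 1 / ((n : ℝ) + 1)) : clampF n t = 0 := by
  unfold clampF
  have hn : (0 : ℝ) < (n : ℝ) + 1 := by positivity
  rw [le_div_iff₀ hn] at ht
  exact max_eq_left ((min_le_right _ _).trans (by linarith))

lemma truncF_deriv (n : ℕ) (t : ℝ) : HasDerivAt (truncF n) (clampF n t) t :=
  intervalIntegral.integral_hasDerivAt_right ((clampF_cont n).intervalIntegrable _ _)
    (clampF_cont n).stronglyMeasurable.stronglyMeasurableAtFilter (clampF_cont n).continuousAt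

lemma truncF_contDiff (n : ℕ) : ContDiff ℝ 1 (truncF n) := by
  rw [contDiff_one_iff_deriv]
  refine ⟨fun t => (truncF_deriv n t).differentiableAt, ?_⟩
  rw [show deriv (truncF n) = clampF n from funext fun t => (truncF_deriv n t).deriv]
  exact clampF_cont n

lemma truncF_abs_le (n : ℕ) (t : ℝ) : |truncF n t| ≤ |t| := by
  have := intervalIntegral.norm_integral_le_of_norm_le_const (a := 0) (b := t) (f := clampF n)
    (C := 1) (fun x _ => by
      rw [Real.norm_eq_abs, abs_of_nonneg (clampF_nonneg n x)]; exact clampF_le n x)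
  simpa [truncF] using this

lemma truncF_zero {n : ℕ} {t : ℝ} (ht0 : 0 ≤ t) (ht : t ≤ 1 / ((n : ℝ) + 1)) : truncF n t = 0 := by
  unfold truncF
  rw [intervalIntegral.integral_congr (g := fun _ => (0 : ℝ))]
  · simp
  · intro x hx
    rw [uIcc_of_le ht0] at hx
    exact clampF_zero (hx.2.trans ht)

lemma truncF_tendsto {t : ℝ} (ht : 0 < t) : Tendsto (fun n => truncF n t) atTop (𝓝 t) := by
  have := intervalIntegral.tendsto_integral_filter_of_dominated_convergence (a := 0) (b := t)
    (μ := volume) (l := atTop) (F := clampF) (f := fun _ => (1 : ℝ)) (fun _ => (1 : ℝ))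
    (Eventually.of_forall fun n => (clampF_cont n).aestronglyMeasurable)
    (Eventually.of_forall fun n => Eventually.of_forall fun x _ => by
      rw [Real.norm_eq_abs, abs_of_nonneg (clampF_nonneg n x)]; exact clampF_le n x)
    (by simp) (Eventually.of_forall fun x hx => by
      rw [uIoc_of_le ht.le] at hx
      exact clampF_tendsto hx.1)
  simpa [truncF] using this

/-- the weak identity for positive `C¹₀` functions -/
lemma WI_pos (h0 : 0 < R₀) (h1 : R₀ < R₁) {p : ℝ} (hp : 2 < p) {u : EE → ℝ}
    (hsol : IsWeakSolution N R₀ R₁ (fun _ => 1) p u) {w : EE → ℝ}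
    (hw : memC10 N R₀ R₁ w) (hpos : ∀ x ∈ annulus N R₀ R₁, 0 < w x) :
    WI N R₀ R₁ p u w (gW N R₀ R₁ w) := by
  classical
  have hcl := closure_annulus (N := N) h0 h1
  let ψ : ℕ → EE → ℝ := fun n => (annulus N R₀ R₁).indicator (fun x => truncF n (w x))
  let K : ℕ → Set EE := fun n => closure (annulus N R₀ R₁) ∩ w ⁻¹' (Ici (1 / ((n : ℝ) + 1)))
  have hKc : ∀ n, IsClosed (K n) := fun n =>
    hw.1.continuousOn.preimage_isClosed_of_isClosed isClosed_closure isClosed_Ici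
  have hKcomp : ∀ n, IsCompact (K n) := fun n =>
    (isCompact_cl h0 h1).of_isClosed_subset (hKc n) inter_subset_left
  have hKA : ∀ n, K n ⊆ annulus N R₀ R₁ := by
    rintro n x ⟨hx, hx2⟩
    rw [hcl] at hx
    have hx3 : 0 < w x := lt_of_lt_of_le (by positivity) hx2
    refine ⟨lt_of_le_of_ne hx.1 fun h => ?_, lt_of_le_of_ne hx.2 fun h => ?_⟩
    · exact hx3.ne' (hw.2 x (Or.inl h.symm))
    · exact hx3.ne' (hw.2 x (Or.inr h))
  have hzero : ∀ n x, x ∉ K n → ψ n x = 0 := by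
    intro n x hx
    by_cases hA : x ∈ annulus N R₀ R₁
    · simp only [ψ, indicator_of_mem hA]
      apply truncF_zero (hpos x hA).le
      by_contra hlt
      exact hx ⟨subset_closure hA, (not_le.1 hlt).le⟩
    · simp only [ψ, indicator_of_notMem hA]
  have hts : ∀ n, tsupport (ψ n) ⊆ K n := fun n => by
    refine closure_minimal (fun x hx => ?_) (hKc n)
    by_contra h
    exact hx (hzero n x h)
  have hev : ∀ n, ∀ x ∈ annulus N R₀ R₁, ψ n =ᶠ[𝓝 x] fun y => truncF n (w y) := by
    intro n x hx
    filter_upwards [annulus_isOpen.mem_nhds hx] with y hy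
    simp only [ψ, indicator_of_mem hy]
  have hwA : ∀ x ∈ annulus N R₀ R₁, ContDiffAt ℝ 1 w x := fun x hx =>
    hw.1.contDiffAt (mem_of_superset (annulus_isOpen.mem_nhds hx) subset_closure)
  have hψ : ∀ n, ContDiff ℝ 1 (ψ n) := by
    intro n
    rw [contDiff_iff_contDiffAt]
    intro x
    by_cases hx : x ∈ K n
    · have hA := hKA n hx
      exact ((truncF_contDiff n).contDiffAt.comp x (hwA x hA)).congr_of_eventuallyEq (hev n x hA)
    · refine (contDiffAt_const (c := (0 : ℝ))).congr_of_eventuallyEq ?_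
      filter_upwards [(hKc n).isOpen_compl.mem_nhds hx] with y hy
      exact hzero n y hy
  have hgr : ∀ n, ∀ x ∈ annulus N R₀ R₁, gradient (ψ n) x = clampF n (w x) • gW N R₀ R₁ w x := by
    intro n x hx
    have hd : HasFDerivAt w (fderiv ℝ w x) x :=
      ((hwA x hx).differentiableAt one_ne_zero).hasFDerivAt
    have h2 := (truncF_deriv n (w x)).comp_hasFDerivAt x hd
    have h3 : fderiv ℝ (ψ n) x = clampF n (w x) • fderiv ℝ w x := by
      rw [(hev n x hx).fderiv_eq]
      exact h2.fderiv
    rw [gradient, h3, gW, fdW_eq hx]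
    simp
  have hsub : annulus N R₀ R₁ ⊆ closure (annulus N R₀ R₁) := subset_closure
  obtain ⟨M1, hM1⟩ := (isCompact_cl (N := N) h0 h1).exists_bound_of_continuousOn hw.1.continuousOn
  obtain ⟨M2, hM2⟩ := (isCompact_cl (N := N) h0 h1).exists_bound_of_continuousOn
    (cont_gW h0 h1 hw.1)
  refine WI_lim h0 h1 hp hsol.1.1 (gn := ψ) (Gn := fun n => gradient (ψ n))
    (C := max M1 M2) ?_ ?_ ?_ ?_ ?_ ?_ ?_
  · intro n
    exact WI_C1c h0 h1 hp hsol (hψ n)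
      ((hKcomp n).of_isClosed_subset (isClosed_tsupport _) (hts n)) ((hts n).trans (hKA n))
  · intro n
    exact (hψ n).continuous.continuousOn
  · intro n
    have : Continuous (fderiv ℝ (ψ n)) := (hψ n).continuous_fderiv one_ne_zero
    exact ((LinearIsometryEquiv.continuous _).comp this).continuousOn
  · intro n x hx
    simp only [ψ, indicator_of_mem hx]
    exact (truncF_abs_le _ _).trans ((hM1 x (hsub hx)).trans (le_max_left _ _))
  · intro n x hx
    rw [hgr n x hx, norm_smul, Real.norm_eq_abs, abs_of_nonneg (clampF_nonneg _ _)]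
    refine (mul_le_of_le_one_left (norm_nonneg _) (clampF_le _ _)).trans
      ((hM2 x (hsub hx)).trans (le_max_right _ _))
  · intro x hx
    simp only [ψ, indicator_of_mem hx]
    exact truncF_tendsto (hpos x hx)
  · intro x hx
    simp_rw [hgr _ x hx]
    simpa using (clampF_tendsto (hpos x hx)).smul_const (gW N R₀ R₁ w x)

/-- a second order lower bound for the power -/
lemma taylor_low {p M ε : ℝ} (hp : 2 < p) (hε : 0 < ε) :
    ∃ δ : ℝ, 0 < δ ∧ ∀ a ∈ Icc 0 M, ∀ b ∈ Icc 0 M, |b - a| < δ →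
      a ^ p + p * a ^ (p - 1) * (b - a) + p * (p - 1) / 2 * (a ^ (p - 2) - ε) * (b - a) ^ 2
        ≤ b ^ p := by
  have huc : UniformContinuousOn (fun t : ℝ => t ^ (p - 2)) (Icc 0 M) :=
    isCompact_Icc.uniformContinuousOn_of_continuous
      (continuousOn_id.rpow_const (fun x _ => Or.inr (by linarith)))
  obtain ⟨δ, hδ, H⟩ := Metric.uniformContinuousOn_iff.1 huc ε hε
  refine ⟨δ, hδ, fun a ha b hb hab => ?_⟩
  set c := p * (p - 1) / 2 * (a ^ (p - 2) - ε) with hc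
  let g : ℝ → ℝ := fun t => t ^ p - a ^ p - p * a ^ (p - 1) * (t - a) - c * (t - a) ^ 2
  let g' : ℝ → ℝ := fun t => p * t ^ (p - 1) - p * a ^ (p - 1) - 2 * c * (t - a)
  let g'' : ℝ → ℝ := fun t => p * ((p - 1) * t ^ (p - 2)) - 2 * c
  have hg : ∀ t, HasDerivAt g (g' t) t := by
    intro t
    have e1 := Real.hasDerivAt_rpow_const (x := t) (p := p) (Or.inr (by linarith))
    have e2 := ((hasDerivAt_id t).sub_const a)
    have e3 := ((e1.sub_const (a ^ p)).sub (e2.const_mul (p * a ^ (p - 1)))).sub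
      ((e2.pow 2).const_mul c)
    refine HasDerivAt.congr_deriv (f := g) e3 ?_
    simp [g']
    ring
  have hg' : ∀ t, HasDerivAt g' (g'' t) t := by
    intro t
    have e1 := Real.hasDerivAt_rpow_const (x := t) (p := p - 1) (Or.inr (by linarith))
    have e2 := ((hasDerivAt_id t).sub_const a)
    have e3 := (((e1.const_mul p).sub_const (p * a ^ (p - 1)))).sub (e2.const_mul (2 * c))
    refine HasDerivAt.congr_deriv (f := g') e3 ?_
    simp only [g'']
    rw [show p - 1 - 1 = p - 2 by ring]
    ring
  have hsub : uIcc a b ⊆ Icc 0 M := by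
    intro x hx
    rcases le_total a b with h | h
    · rw [uIcc_of_le h] at hx; exact ⟨ha.1.trans hx.1, hx.2.trans hb.2⟩
    · rw [uIcc_of_ge h] at hx; exact ⟨hb.1.trans hx.1, hx.2.trans ha.2⟩
  have hconv : ConvexOn ℝ (uIcc a b) g := by
    refine convexOn_of_hasDerivWithinAt2_nonneg (f' := g') (f'' := g'') (convex_uIcc a b)
      (fun x _ => (hg x).continuousAt.continuousWithinAt) (fun x _ => (hg x).hasDerivWithinAt)
      (fun x _ => (hg' x).hasDerivWithinAt) ?_
    intro x hx
    have hx' := interior_subset hx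
    have h1 := H x (hsub hx') a ha
      (lt_of_le_of_lt (by rw [Real.dist_eq]; exact abs_sub_left_of_mem_uIcc hx') hab)
    rw [Real.dist_eq, abs_lt] at h1
    have : g'' x = p * (p - 1) * (x ^ (p - 2) - a ^ (p - 2) + ε) := by
      simp only [g'', hc]; ring
    rw [this]
    have : 0 < p - 1 := by linarith
    exact mul_nonneg (by positivity) (by linarith [h1.1])
  have hga : g a = 0 := by simp [g]
  have hg'a : g' a = 0 := by simp [g']
  have hda : HasDerivAt g 0 a := hg'a ▸ hg a
  have hgb : 0 ≤ g b := by
    rcases lt_trichotomy a b with h | h | h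
    · have := hconv.le_slope_of_hasDerivAt left_mem_uIcc right_mem_uIcc h hda
      rw [slope_def_field, hga, sub_zero] at this
      have h3 : 0 < b - a := by linarith
      have := mul_nonneg this h3.le
      rwa [div_mul_cancel₀ _ h3.ne'] at this
    · rw [← h, hga]
    · have := hconv.slope_le_of_hasDerivAt right_mem_uIcc left_mem_uIcc h hda
      rw [slope_def_field, hga, zero_sub] at this
      have h3 : 0 < a - b := by linarith
      have := mul_nonpos_of_nonpos_of_nonneg this h3.le
      rw [div_mul_cancel₀ _ h3.ne'] at this
      linarith
  simp only [g] at hgb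
  linarith

lemma power_small {E q m p : ℝ} (hE : 0 < E) (hm : p / 2 * q < m) :
    ∃ δ : ℝ, 0 < δ ∧ ∀ y, 0 < y → y < δ → ((E + y * q) / E) ^ (p / 2) < (E + y * m) / E := by
  have hd : HasDerivAt (fun y : ℝ => (E + y * m) / E - ((E + y * q) / E) ^ (p / 2))
      (m / E - q / E * (p / 2) * ((E + 0 * q) / E) ^ (p / 2 - 1)) 0 := by
    have e1 : ∀ k : ℝ, HasDerivAt (fun y : ℝ => (E + y * k) / E) (k / E) 0 := by
      intro k
      simpa using (((hasDerivAt_id (0 : ℝ)).mul_const k).const_add E).div_const E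
    exact (e1 m).sub ((e1 q).rpow_const (Or.inl (by simp [hE.ne'])))
  have hpos : 0 < m / E - q / E * (p / 2) * ((E + 0 * q) / E) ^ (p / 2 - 1) := by
    have : (E + 0 * q) / E = 1 := by field_simp; ring
    rw [this, Real.one_rpow]
    have : m / E - q / E * (p / 2) * 1 = (m - p / 2 * q) / E := by ring
    rw [this]
    exact div_pos (by linarith) hE
  rw [hasDerivAt_iff_tendsto_slope] at hd
  have h2 := hd.eventually (lt_mem_nhds hpos)
  rw [eventually_nhdsWithin_iff, Metric.eventually_nhds_iff] at h2
  obtain ⟨δ, hδ, H⟩ := h2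
  refine ⟨δ, hδ, fun y hy hyd => ?_⟩
  have h3 := H (y := y) (by rw [Real.dist_eq, sub_zero, abs_of_pos hy]; exact hyd) (by simpa using hy.ne')
  rw [slope_def_field, sub_zero] at h3
  have h4 := mul_pos h3 hy
  rw [div_mul_cancel₀ _ hy.ne'] at h4
  simp [hE.ne'] at h4
  linarith

lemma nehari_real {E Q P p : ℝ} (hE : 0 < E) (hQ : 0 < Q) (hP : 0 < P) (hp : 2 < p)
    (h : (Q / E) ^ (p / 2) < P / E) :
    ∃ t : ℝ, 0 < t ∧ t ^ 2 * Q = t ^ p * P ∧ t ^ 2 * Q < E := by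
  have hp2 : 0 < p - 2 := by linarith
  have hQP : 0 < Q / P := by positivity
  have hQE : 0 < Q / E := by positivity
  refine ⟨(Q / P) ^ (1 / (p - 2)), by positivity, ?_, ?_⟩
  · have ht : 0 < (Q / P) ^ (1 / (p - 2)) := by positivity
    have : ((Q / P) ^ (1 / (p - 2))) ^ p = ((Q / P) ^ (1 / (p - 2))) ^ (2 : ℕ) * (Q / P) := by
      have key : ∀ T : ℝ, 0 < T → T ^ p = T ^ 2 * T ^ (p - 2) := by
        intro T hT
        rw [← Real.rpow_two, ← Real.rpow_add hT]
        congr 1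
        ring
      rw [key _ ht, ← Real.rpow_mul hQP.le (1 / (p - 2)) (p - 2),
        one_div_mul_cancel hp2.ne', Real.rpow_one]
    rw [this]
    field_simp
  · have e1 : ((Q / P) ^ (1 / (p - 2))) ^ 2 = (Q / P) ^ (2 / (p - 2)) := by
      rw [← Real.rpow_two, ← Real.rpow_mul hQP.le]
      congr 1
      ring
    have e2 : Q / P < (Q / E) ^ ((2 - p) / 2) := by
      have : (2 - p) / 2 = 1 - p / 2 := by ring
      rw [this, Real.rpow_sub hQE, Real.rpow_one]
      rw [lt_div_iff₀ (by positivity)]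
      calc Q / P * (Q / E) ^ (p / 2) < Q / P * (P / E) := by gcongr
        _ = Q / E := by field_simp
    have e3 : (Q / P) ^ (2 / (p - 2)) < E / Q := by
      calc (Q / P) ^ (2 / (p - 2)) < ((Q / E) ^ ((2 - p) / 2)) ^ (2 / (p - 2)) :=
            Real.rpow_lt_rpow hQP.le e2 (by positivity)
        _ = (Q / E) ^ (-1 : ℝ) := by
            rw [← Real.rpow_mul hQE.le]
            congr 1
            field_simp
            ring
        _ = E / Q := by rw [Real.rpow_neg_one, inv_div]
    rw [e1]
    calc _ < E / Q * Q := by gcongr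
      _ = E := by field_simp

open Measure in
/-- radial times zero-spherical-mean integrates to zero -/
lemma polar_zero (hN : 3 ≤ N) (h0 : 0 < R₀) (h1 : R₀ < R₁) {c v : EE → ℝ}
    (hc : ContinuousOn c (closure (annulus N R₀ R₁)))
    (hv : ContinuousOn v (closure (annulus N R₀ R₁)))
    (hrad : ∃ U : ℝ → ℝ, ∀ x ∈ closure (annulus N R₀ R₁), c x = U ‖x‖)
    (h4 : ∀ r ∈ Ioo R₀ R₁,
      (∫ σ : Metric.sphere (0 : EE) 1, v (r • (σ : EE))
        ∂((volume : Measure (EuclideanSpace ℝ (Fin N))).toSphere)) = 0) :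
    ∫ x in annulus N R₀ R₁, c x * v x = 0 := by
  obtain ⟨U, hU⟩ := hrad
  have : Nontrivial EE := by
    have : Nonempty (Fin N) := ⟨⟨0, by omega⟩⟩
    infer_instance
  have hm : MeasurableSet (annulus N R₀ R₁) := annulus_isOpen.measurableSet
  have hi := integrable_of_cont h0 h1 (hc.mul hv)
  let F : EE → ℝ := (annulus N R₀ R₁).indicator (fun x => c x * v x)
  have hF : Integrable F volume := (integrable_indicator_iff hm).2 hi
  rw [← integral_indicator hm]
  change ∫ x, F x = 0
  let Gf : Metric.sphere (0 : EE) 1 × Ioi (0 : ℝ) → ℝ := fun y => F (y.2.1 • y.1.1)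
  have hcomp : ∀ x : ({0}ᶜ : Set EE), Gf (homeomorphUnitSphereProd EE x) = F x := by
    intro x
    have h := congrArg Subtype.val ((homeomorphUnitSphereProd EE).symm_apply_apply x)
    rw [homeomorphUnitSphereProd_symm_apply_coe] at h
    simp only [Gf]
    rw [h]
  have hmp := (volume : Measure EE).measurePreserving_homeomorphUnitSphereProd
  have hGi : Integrable Gf ((volume : Measure EE).toSphere.prod
      (volumeIoiPow (Module.finrank ℝ EE - 1))) := by
    rw [← hmp.integrable_comp_emb (Homeomorph.measurableEmbedding _)]
    have : (Gf ∘ homeomorphUnitSphereProd EE) = F ∘ Subtype.val := funext hcomp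
    rw [this, ← integrableOn_iff_comap_subtypeVal (measurableSet_singleton _).compl]
    exact hF.integrableOn
  calc ∫ x, F x = ∫ x : ({(0)}ᶜ : Set EE), F x ∂((volume : Measure EE).comap (↑)) := by
        rw [integral_subtype_comap (measurableSet_singleton _).compl F, restrict_compl_singleton]
    _ = ∫ y, Gf y ∂((volume : Measure EE).toSphere.prod
          (volumeIoiPow (Module.finrank ℝ EE - 1))) := by
        rw [← hmp.integral_comp (Homeomorph.measurableEmbedding _) Gf]
        simp_rw [hcomp]
    _ = 0 := by
        rw [integral_prod_symm _ hGi]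
        apply integral_eq_zero_of_ae
        refine Eventually.of_forall fun r => ?_
        have hnorm : ∀ σ : Metric.sphere (0 : EE) 1, ‖r.1 • σ.1‖ = r.1 := by
          intro σ
          have hr : (0 : ℝ) < r.1 := r.2
          rw [norm_smul, Real.norm_eq_abs, abs_of_pos hr, mem_sphere_zero_iff_norm.1 σ.2, mul_one]
        by_cases hr : r.1 ∈ Ioo R₀ R₁
        · have : ∀ σ : Metric.sphere (0 : EE) 1, Gf (σ, r) = U r.1 * v (r.1 • σ.1) := by
            intro σ
            have hA : r.1 • σ.1 ∈ annulus N R₀ R₁ := by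
              simp only [annulus, mem_ofPred_eq, hnorm]; exact hr
            simp only [Gf, F, indicator_of_mem hA]
            rw [hU _ (subset_closure hA), hnorm]
          simp only [this]
          rw [integral_const_mul, h4 r.1 hr]
          simp
        · have : ∀ σ : Metric.sphere (0 : EE) 1, Gf (σ, r) = 0 := by
            intro σ
            have hA : r.1 • σ.1 ∉ annulus N R₀ R₁ := by
              simp only [annulus, mem_ofPred_eq, hnorm]; exact hr
            simp only [Gf, F, indicator_of_notMem hA]
          simp [this]

lemma H1sq_nonneg (f : EE → ℝ) : 0 ≤ H1sq N R₀ R₁ f :=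
  integral_nonneg fun x => by positivity

/-- expansion of the `H¹` norm of a linear combination -/
lemma H1sq_comb (h0 : 0 < R₀) (h1 : R₀ < R₁) {u v : EE → ℝ}
    (hu : ContDiffOn ℝ 1 u (closure (annulus N R₀ R₁)))
    (hv : ContDiffOn ℝ 1 v (closure (annulus N R₀ R₁))) (a b : ℝ) :
    H1sq N R₀ R₁ (fun y => a * u y + b * v y) = a ^ 2 * H1sq N R₀ R₁ u + b ^ 2 * H1sq N R₀ R₁ v
      + 2 * a * b * ∫ x in annulus N R₀ R₁,
        (inner ℝ (gW N R₀ R₁ u x) (gW N R₀ R₁ v x) + u x * v x) := by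
  have hm : MeasurableSet (annulus N R₀ R₁) := annulus_isOpen.measurableSet
  have hgu := cont_gW h0 h1 hu
  have hgv := cont_gW h0 h1 hv
  have i1 : Integrable (fun x => ‖gW N R₀ R₁ u x‖ ^ 2 + u x ^ 2) (volume.restrict (annulus N R₀ R₁)) :=
    integrable_of_cont h0 h1 ((hgu.norm.pow 2).add (hu.continuousOn.pow 2))
  have i2 : Integrable (fun x => ‖gW N R₀ R₁ v x‖ ^ 2 + v x ^ 2) (volume.restrict (annulus N R₀ R₁)) :=
    integrable_of_cont h0 h1 ((hgv.norm.pow 2).add (hv.continuousOn.pow 2))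
  have i3 : Integrable (fun x => inner ℝ (gW N R₀ R₁ u x) (gW N R₀ R₁ v x) + u x * v x) (volume.restrict (annulus N R₀ R₁)) :=
    integrable_of_cont h0 h1 ((hgu.inner (𝕜 := ℝ) hgv).add
    (hu.continuousOn.mul hv.continuousOn))
  unfold H1sq
  simp only [← norm_gW]
  rw [← integral_const_mul, ← integral_const_mul, ← integral_const_mul,
    ← integral_add (i1.const_mul _) (i2.const_mul _),
    ← integral_add ((i1.const_mul _).fun_add (i2.const_mul _)) (i3.const_mul _)]
  refine setIntegral_congr_fun hm fun x hx => ?_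
  try beta_reduce
  rw [gW_add_smul h0 h1 a b hu hv (subset_closure hx), norm_add_sq_real, norm_smul, norm_smul,
    real_inner_smul_left, real_inner_smul_right, mul_pow, mul_pow, Real.norm_eq_abs,
    Real.norm_eq_abs, sq_abs, sq_abs]
  ring

end Aux

set_option maxHeartbeats 2000000

/-- instability criterion entailing `c_I < I(u_rad)` (case `a ≡ 1`). -/
theorem statement13 (N : ℕ) (hN : 3 ≤ N) (R₀ R₁ : ℝ) (hR₀ : 0 < R₀) (hR : R₀ < R₁)
    (p : ℝ) (hp : 2 < p)
    (urad : EuclideanSpace ℝ (Fin N) → ℝ)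
    (hsol : IsWeakSolution N R₀ R₁ (fun _ => 1) p urad)
    (hradial : ∃ U : ℝ → ℝ, ∀ x ∈ closure (annulus N R₀ R₁), urad x = U ‖x‖)
    (hpos : ∀ x ∈ annulus N R₀ R₁, 0 < urad x)
    (hint : ∃ ε₀ : ℝ, 0 < ε₀ ∧
      ∀ w : EuclideanSpace ℝ (Fin N) → ℝ, memC10 N R₀ R₁ w →
        C1dist N R₀ R₁ w urad < ε₀ → ∀ x ∈ annulus N R₀ R₁, 0 ≤ w x)
    (v : EuclideanSpace ℝ (Fin N) → ℝ) (𝔳 : ℝ → ℝ → ℝ)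
    (hv : memC10 N R₀ R₁ v) (hvax : IsAxiallySymmRep N R₀ R₁ v 𝔳)
    (h1 : (∫ x in annulus N R₀ R₁,
        (‖fderivWithin ℝ v (closure (annulus N R₀ R₁)) x‖ ^ 2 + v x ^ 2
          - (p - 1) * urad x ^ (p - 2) * v x ^ 2)) < 0)
    (h2 : ∀ r ∈ Icc R₀ R₁, AntitoneOn (𝔳 r) (Icc 0 (π / 2)))
    (h3 : ∀ r ∈ Icc R₀ R₁, ∀ θ : ℝ, 𝔳 r (-θ) = 𝔳 r θ)
    (h4 : ∀ r ∈ Ioo R₀ R₁,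
      (∫ σ : Metric.sphere (0 : EuclideanSpace ℝ (Fin N)) 1,
        v (r • (σ : EuclideanSpace ℝ (Fin N)))
        ∂((volume : Measure (EuclideanSpace ℝ (Fin N))).toSphere)) = 0) :
    cI N R₀ R₁ (fun _ => 1) p < funcI N R₀ R₁ (fun _ => 1) p urad ∧
    ¬ (memNehari N R₀ R₁ (fun _ => 1) p urad ∧
        funcI N R₀ R₁ (fun _ => 1) p urad = cI N R₀ R₁ (fun _ => 1) p) := by
  classical
  have hm : MeasurableSet (annulus N R₀ R₁) := annulus_isOpen.measurableSet
  have hsub : annulus N R₀ R₁ ⊆ closure (annulus N R₀ R₁) := subset_closure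
  have hcl := closure_annulus (N := N) hR₀ hR
  have hu := hsol.1
  have hcu := hu.1.continuousOn
  have hcv := hv.1.continuousOn
  have hgu := cont_gW hR₀ hR hu.1
  have hgv := cont_gW hR₀ hR hv.1
  have hp0 : 0 < p := by linarith
  have hp1 : 0 < p - 1 := by linarith
  have hp2 : 0 < p - 2 := by linarith
  have hu0 : ∀ x ∈ closure (annulus N R₀ R₁), 0 ≤ urad x := by
    intro x hx
    by_cases hA : x ∈ annulus N R₀ R₁
    · exact (hpos x hA).le
    · rw [hcl] at hx
      have : ‖x‖ = R₀ ∨ ‖x‖ = R₁ := by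
        by_contra! hne
        exact hA ⟨lt_of_le_of_ne hx.1 hne.1.symm, lt_of_le_of_ne hx.2 hne.2⟩
      rw [hu.2 x this]
  -- bounds
  obtain ⟨Mu, hMu⟩ := (isCompact_cl (N := N) hR₀ hR).exists_bound_of_continuousOn hcu
  obtain ⟨Mv', hMv'⟩ := (isCompact_cl (N := N) hR₀ hR).exists_bound_of_continuousOn hcv
  obtain ⟨Mg', hMg'⟩ := (isCompact_cl (N := N) hR₀ hR).exists_bound_of_continuousOn hgv
  obtain ⟨Mv, hMvd⟩ : ∃ M, M = max Mv' 0 := ⟨_, rfl⟩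
  obtain ⟨Mg, hMgd⟩ : ∃ M, M = max Mg' 0 := ⟨_, rfl⟩
  have hMv0 : 0 ≤ Mv := hMvd ▸ le_max_right _ _
  have hMg0 : 0 ≤ Mg := hMgd ▸ le_max_right _ _
  have hMv : ∀ x ∈ closure (annulus N R₀ R₁), |v x| ≤ Mv := fun x hx =>
    (hMv' x hx).trans (hMvd ▸ le_max_left _ _)
  have hMg : ∀ x ∈ closure (annulus N R₀ R₁), ‖gW N R₀ R₁ v x‖ ≤ Mg := fun x hx =>
    (hMg' x hx).trans (hMgd ▸ le_max_left _ _)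
  obtain ⟨ε₀, hε₀, hint⟩ := hint
  have comb_C10 : ∀ a b : ℝ, memC10 N R₀ R₁ (fun y => a * urad y + b * v y) := fun a b =>
    ⟨(contDiffOn_const.mul hu.1).add (contDiffOn_const.mul hv.1), fun x hx => by
      simp [hu.2 x hx, hv.2 x hx]⟩
  -- nonnegativity for small parameters
  have hnn : ∀ s : ℝ, 0 ≤ s → s * (Mv + Mg) < ε₀ → ∀ x ∈ annulus N R₀ R₁,
      0 ≤ 1 * urad x + s * v x := by
    intro s hs hsm
    refine hint _ (comb_C10 1 s) (lt_of_le_of_lt ?_ hsm)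
    unfold C1dist
    rw [mul_add]
    refine add_le_add ?_ ?_
    · refine Real.iSup_le (fun x => ?_) (by positivity)
      rw [show 1 * urad x + s * v x - urad x = s * v x by ring, abs_mul, abs_of_nonneg hs]
      exact mul_le_mul_of_nonneg_left (hMv x x.2) hs
    · refine Real.iSup_le (fun x => ?_) (by positivity)
      rw [← (InnerProductSpace.toDual ℝ (EuclideanSpace ℝ (Fin N))).symm.norm_map, map_sub]
      have h := gW_add_smul hR₀ hR 1 s hu.1 hv.1 x.2
      simp only [gW] at h
      rw [h, one_smul, add_sub_cancel_left, norm_smul, Real.norm_eq_abs, abs_of_nonneg hs]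
      exact mul_le_mul_of_nonneg_left (hMg x x.2) hs
  have hposs : ∀ s : ℝ, 0 ≤ s → 2 * s * (Mv + Mg) < ε₀ → ∀ x ∈ annulus N R₀ R₁,
      0 < 1 * urad x + s * v x := by
    intro s hs hsm x hx
    have := hnn (2 * s) (by linarith) hsm x hx
    linarith [hpos x hx]
  obtain ⟨s₀, hs₀, hs₀'⟩ : ∃ s₀ : ℝ, 0 < s₀ ∧ 2 * s₀ * (Mv + Mg) < ε₀ := by
    refine ⟨ε₀ / (2 * (Mv + Mg + 1)), by positivity, ?_⟩
    rw [show 2 * (ε₀ / (2 * (Mv + Mg + 1))) * (Mv + Mg) = ε₀ * (Mv + Mg) / (Mv + Mg + 1) by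
      field_simp, div_lt_iff₀ (by positivity)]
    nlinarith
  -- integrability
  have hcp := cont_pow hp hcu
  have iuu : Integrable (fun x => inner ℝ (gW N R₀ R₁ urad x) (gW N R₀ R₁ urad x) + urad x * urad x) (volume.restrict (annulus N R₀ R₁)) :=
    integrable_of_cont hR₀ hR ((hgu.inner (𝕜 := ℝ) hgu).add (hcu.mul hcu))
  have iuv : Integrable (fun x => inner ℝ (gW N R₀ R₁ urad x) (gW N R₀ R₁ v x) + urad x * v x) (volume.restrict (annulus N R₀ R₁)) :=
    integrable_of_cont hR₀ hR ((hgu.inner (𝕜 := ℝ) hgv).add (hcu.mul hcv))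
  have ipu : Integrable (fun x => |urad x| ^ (p - 2) * urad x * urad x) (volume.restrict (annulus N R₀ R₁)) :=
    integrable_of_cont hR₀ hR (hcp.mul hcu)
  have ipv : Integrable (fun x => |urad x| ^ (p - 2) * urad x * v x) (volume.restrict (annulus N R₀ R₁)) :=
    integrable_of_cont hR₀ hR (hcp.mul hcv)
  -- weak identities
  have W1 := WI_pos hR₀ hR hp hsol hu hpos
  have W2 := WI_pos hR₀ hR hp hsol (comb_C10 1 s₀) (hposs s₀ hs₀.le hs₀')
  unfold WI at W1 W2
  have hrad : ∃ V : ℝ → ℝ, ∀ x ∈ closure (annulus N R₀ R₁),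
      |urad x| ^ (p - 2) * urad x = V ‖x‖ := by
    obtain ⟨U, hU⟩ := hradial
    exact ⟨fun r => |U r| ^ (p - 2) * U r, fun x hx => by rw [hU x hx]⟩
  have hZ := polar_zero hN hR₀ hR hcp hcv hrad h4
  have hX : ∫ x in annulus N R₀ R₁,
      (inner ℝ (gW N R₀ R₁ urad x) (gW N R₀ R₁ v x) + urad x * v x) = 0 := by
    have e1 : ∫ x in annulus N R₀ R₁, (inner ℝ (gW N R₀ R₁ urad x)
        (gW N R₀ R₁ (fun y => 1 * urad y + s₀ * v y) x) + urad x * (1 * urad x + s₀ * v x))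
        = (∫ x in annulus N R₀ R₁, (inner ℝ (gW N R₀ R₁ urad x) (gW N R₀ R₁ urad x)
            + urad x * urad x)) + s₀ * ∫ x in annulus N R₀ R₁,
          (inner ℝ (gW N R₀ R₁ urad x) (gW N R₀ R₁ v x) + urad x * v x) := by
      rw [← integral_const_mul, ← integral_add iuu (iuv.const_mul _)]
      refine setIntegral_congr_fun hm fun x hx => ?_
      try beta_reduce
      rw [gW_add_smul hR₀ hR 1 s₀ hu.1 hv.1 (hsub hx), inner_add_right, one_smul,
        real_inner_smul_right]
      ring
    have e2 : ∫ x in annulus N R₀ R₁, |urad x| ^ (p - 2) * urad x * (1 * urad x + s₀ * v x)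
        = (∫ x in annulus N R₀ R₁, |urad x| ^ (p - 2) * urad x * urad x)
          + s₀ * ∫ x in annulus N R₀ R₁, |urad x| ^ (p - 2) * urad x * v x := by
      rw [← integral_const_mul, ← integral_add ipu (ipv.const_mul _)]
      refine setIntegral_congr_fun hm fun x hx => ?_
      try beta_reduce
      ring
    beta_reduce at W2
    rw [e1, e2, W1, hZ] at W2
    have : s₀ * ∫ x in annulus N R₀ R₁,
      (inner ℝ (gW N R₀ R₁ urad x) (gW N R₀ R₁ v x) + urad x * v x) = 0 := by linarith
    exact (mul_eq_zero.1 this).resolve_left hs₀.ne'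
  -- energy of urad
  have hpw : ∀ x ∈ annulus N R₀ R₁, |urad x| ^ (p - 2) * urad x * urad x = urad x ^ p := by
    intro x hx
    have h := hpos x hx
    rw [abs_of_pos h, mul_assoc, ← sq, ← Real.rpow_two, ← Real.rpow_add h]
    congr 1
    ring
  have hpw1 : ∀ x ∈ annulus N R₀ R₁, |urad x| ^ (p - 2) * urad x = urad x ^ (p - 1) := by
    intro x hx
    have h := hpos x hx
    nth_rewrite 2 [← Real.rpow_one (urad x)]
    rw [abs_of_pos h, ← Real.rpow_add h]
    congr 1
    ring
  obtain ⟨E, hE⟩ : ∃ E, E = H1sq N R₀ R₁ urad := ⟨_, rfl⟩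
  have hEp : E = ∫ x in annulus N R₀ R₁, urad x ^ p := by
    rw [hE, H1sq, ← setIntegral_congr_fun hm hpw, ← W1]
    refine setIntegral_congr_fun hm fun x hx => ?_
    try beta_reduce
    rw [← norm_gW, real_inner_self_eq_norm_sq]
    ring
  have hcup : ContinuousOn (fun x => urad x ^ p) (closure (annulus N R₀ R₁)) :=
    hcu.rpow_const fun x _ => Or.inr hp0.le
  have hE0 : 0 < E := by
    rw [hEp, setIntegral_pos_iff_support_of_nonneg_ae
      ((ae_restrict_iff' hm).2 (Filter.Eventually.of_forall fun x hx =>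
        (Real.rpow_pos_of_pos (hpos x hx) p).le)) (integrable_of_cont hR₀ hR hcup)]
    have hs : (Function.support fun x => urad x ^ p) ∩ annulus N R₀ R₁ = annulus N R₀ R₁ :=
      inter_eq_right.2 fun x hx => (Real.rpow_pos_of_pos (hpos x hx) p).ne'
    rw [hs]
    refine annulus_isOpen.measure_pos _ ⟨EuclideanSpace.single ⟨0, by omega⟩ ((R₀ + R₁) / 2), ?_⟩
    have : ‖(EuclideanSpace.single ⟨0, by omega⟩ ((R₀ + R₁) / 2) : EuclideanSpace ℝ (Fin N))‖
        = (R₀ + R₁) / 2 := by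
      rw [EuclideanSpace.norm_single, Real.norm_eq_abs, abs_of_pos (by linarith)]
    constructor <;> rw [this] <;> linarith
  -- the quadratic form
  obtain ⟨q, hq⟩ : ∃ q, q = H1sq N R₀ R₁ v := ⟨_, rfl⟩
  have hq0 : 0 ≤ q := hq ▸ H1sq_nonneg v
  have hcu2 : ContinuousOn (fun x => urad x ^ (p - 2) * v x ^ 2) (closure (annulus N R₀ R₁)) :=
    (hcu.rpow_const fun x _ => Or.inr hp2.le).mul (hcv.pow 2)
  have iW := integrable_of_cont hR₀ hR hcu2
  have iV : Integrable (fun x => v x ^ 2) (volume.restrict (annulus N R₀ R₁)) :=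
    integrable_of_cont hR₀ hR (hcv.pow 2)
  have iq : Integrable (fun x => ‖gW N R₀ R₁ v x‖ ^ 2 + v x ^ 2) (volume.restrict (annulus N R₀ R₁)) :=
    integrable_of_cont hR₀ hR ((hgv.norm.pow 2).add (hcv.pow 2))
  have iWV : ∀ ε : ℝ, Integrable (fun x => urad x ^ (p - 2) * v x ^ 2 - ε * v x ^ 2)
      (volume.restrict (annulus N R₀ R₁)) := fun ε => iW.sub (iV.const_mul ε)
  obtain ⟨W, hW⟩ : ∃ W, W = ∫ x in annulus N R₀ R₁, urad x ^ (p - 2) * v x ^ 2 := ⟨_, rfl⟩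
  obtain ⟨V, hV⟩ : ∃ V, V = ∫ x in annulus N R₀ R₁, v x ^ 2 := ⟨_, rfl⟩
  have hV0 : 0 ≤ V := hV ▸ integral_nonneg fun x => sq_nonneg _
  have hD : q - (p - 1) * W < 0 := by
    have : q - (p - 1) * W = ∫ x in annulus N R₀ R₁,
        (‖fderivWithin ℝ v (closure (annulus N R₀ R₁)) x‖ ^ 2 + v x ^ 2
          - (p - 1) * urad x ^ (p - 2) * v x ^ 2) := by
      rw [hq, hW, H1sq, ← integral_const_mul]
      simp only [← norm_gW]
      rw [← integral_sub iq (iW.const_mul _)]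
      refine setIntegral_congr_fun hm fun x hx => ?_
      try beta_reduce
      ring
    rw [this]
    exact h1
  obtain ⟨ε, hε, hε'⟩ : ∃ ε : ℝ, 0 < ε ∧ q < (p - 1) * (W - ε * V) := by
    have hDp : 0 < (p - 1) * W - q := by linarith
    refine ⟨((p - 1) * W - q) / ((p - 1) * (V + 1)), by positivity, ?_⟩
    have e : (p - 1) * (W - ((p - 1) * W - q) / ((p - 1) * (V + 1)) * V)
        = (p - 1) * W - ((p - 1) * W - q) * (V / (V + 1)) := by
      field_simp
    rw [e]
    have : V / (V + 1) < 1 := (div_lt_one (by linarith)).2 (by linarith)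
    nlinarith
  obtain ⟨m, hmd⟩ : ∃ m, m = p * (p - 1) / 2 * (W - ε * V) := ⟨_, rfl⟩
  have hmq : p / 2 * q < m := by
    rw [hmd]
    have := mul_lt_mul_of_pos_left hε' (show 0 < p / 2 by linarith)
    linarith
  obtain ⟨δ₁, hδ₁, T⟩ := taylor_low (M := Mu + Mv) hp hε
  obtain ⟨δ₂, hδ₂, S⟩ := power_small hE0 hmq
  -- the choice of s
  obtain ⟨s, hs, hs1, hss₀, hsδ, hsδ₂⟩ : ∃ s : ℝ, 0 < s ∧ s ≤ 1 ∧ s ≤ s₀ ∧ s * Mv < δ₁ ∧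
      s ^ 2 < δ₂ := by
    refine ⟨min (min 1 s₀) (min (δ₁ / (Mv + 1)) (δ₂ / 2)), by positivity, ?_, ?_, ?_, ?_⟩
    · exact (min_le_left _ _).trans (min_le_left _ _)
    · exact (min_le_left _ _).trans (min_le_right _ _)
    · have h : min (min 1 s₀) (min (δ₁ / (Mv + 1)) (δ₂ / 2)) ≤ δ₁ / (Mv + 1) :=
        (min_le_right _ _).trans (min_le_left _ _)
      rw [le_div_iff₀ (by linarith)] at h
      have h2 : 0 < min (min 1 s₀) (min (δ₁ / (Mv + 1)) (δ₂ / 2)) := by positivity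
      linarith
    · have h : min (min 1 s₀) (min (δ₁ / (Mv + 1)) (δ₂ / 2)) ≤ δ₂ / 2 :=
        (min_le_right _ _).trans (min_le_right _ _)
      have h3 : min (min 1 s₀) (min (δ₁ / (Mv + 1)) (δ₂ / 2)) ≤ 1 :=
        (min_le_left _ _).trans (min_le_left _ _)
      have h2 : 0 < min (min 1 s₀) (min (δ₁ / (Mv + 1)) (δ₂ / 2)) := by positivity
      nlinarith
  have hsmall : 2 * s * (Mv + Mg) < ε₀ := lt_of_le_of_lt (by gcongr) hs₀'
  have hwpos := hposs s hs.le hsmall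
  -- lower bound for the nonlinear term
  have hcw := (comb_C10 1 s).1.continuousOn
  have iP : Integrable (fun x => (1 * urad x + s * v x) ^ p) (volume.restrict (annulus N R₀ R₁)) :=
    integrable_of_cont hR₀ hR (hcw.rpow_const (p := p) fun x _ => Or.inr hp0.le)
  obtain ⟨P, hP⟩ : ∃ P, P = ∫ x in annulus N R₀ R₁, (1 * urad x + s * v x) ^ p := ⟨_, rfl⟩
  have hPlow : E + s ^ 2 * m ≤ P := by
    have e : E + s ^ 2 * m = ∫ x in annulus N R₀ R₁, (urad x ^ p
        + (p * s) * (|urad x| ^ (p - 2) * urad x * v x)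
        + (p * (p - 1) / 2 * s ^ 2) * (urad x ^ (p - 2) * v x ^ 2 - ε * v x ^ 2)) := by
      have iU := integrable_of_cont hR₀ hR hcup
      rw [integral_add (iU.fun_add (ipv.const_mul _)) ((iWV ε).const_mul _),
        integral_add iU (ipv.const_mul _), integral_const_mul, integral_const_mul,
        integral_sub iW (iV.const_mul _), integral_const_mul, hZ, ← hEp, ← hW, ← hV, hmd]
      ring
    rw [e, hP]
    have iU := integrable_of_cont hR₀ hR hcup
    refine setIntegral_mono_on ((iU.fun_add (ipv.const_mul _)).fun_add
      ((iWV ε).const_mul _)) iP hm fun x hx => ?_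
    have hxc := hsub hx
    have hvx := abs_le.1 (hMv x hxc)
    have hux := (le_abs_self _).trans (hMu x hxc)
    have hupos := hpos x hx
    have hw := hwpos x hx
    have hsv : s * v x ≤ Mv := by
      have a1 := mul_le_mul_of_nonneg_left hvx.2 hs.le
      have a2 := mul_le_mul_of_nonneg_right hs1 hMv0
      linarith
    have h := T (urad x) ⟨hupos.le, by linarith⟩ (1 * urad x + s * v x)
      ⟨hw.le, by linarith⟩ (by
        rw [show 1 * urad x + s * v x - urad x = s * v x by ring, abs_mul, abs_of_pos hs]
        exact lt_of_le_of_lt (mul_le_mul_of_nonneg_left (hMv x hxc) hs.le) hsδ)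
    rw [hpw1 x hx]
    refine le_trans (le_of_eq ?_) h
    ring
  have hQ0 : 0 < E + s ^ 2 * q := by positivity
  have hS := S (s ^ 2) (by positivity) hsδ₂
  have hm0 : 0 < m := lt_of_le_of_lt (by positivity) hmq
  have hP0 : 0 < P := lt_of_lt_of_le (by positivity) hPlow
  obtain ⟨t, ht, htN, htE⟩ := nehari_real hE0 hQ0 hP0 hp (hS.trans_le (by gcongr))
  -- the competitor
  obtain ⟨z, hz⟩ : ∃ z : EuclideanSpace ℝ (Fin N) → ℝ,
      z = fun y => t * urad y + (t * s) * v y := ⟨_, rfl⟩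
  have hzpos : ∀ x ∈ annulus N R₀ R₁, 0 < z x := by
    intro x hx
    have := mul_pos ht (hwpos x hx)
    rw [hz]
    try beta_reduce
    linarith
  have hz10 : memC10 N R₀ R₁ z := hz ▸ comb_C10 t (t * s)
  have hzH : H1sq N R₀ R₁ z = t ^ 2 * (E + s ^ 2 * q) := by
    rw [hz, H1sq_comb hR₀ hR hu.1 hv.1, hX, ← hE, ← hq]
    ring
  have hzP : ∫ x in annulus N R₀ R₁, (1 : ℝ) * |z x| ^ p = t ^ p * P := by
    rw [hP, ← integral_const_mul]
    refine setIntegral_congr_fun hm fun x hx => ?_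
    try beta_reduce
    rw [abs_of_pos (hzpos x hx), one_mul, ← Real.mul_rpow ht.le (hwpos x hx).le, hz]
    congr 1
    ring
  have hzN : memNehari N R₀ R₁ (fun _ => 1) p z := by
    refine ⟨⟨⟨hz10.1, ?_, ?_⟩, hz10.2⟩, ?_, ?_⟩
    · intro x hx
      by_cases hA : x ∈ annulus N R₀ R₁
      · exact (hzpos x hA).le
      · rw [hcl] at hx
        have : ‖x‖ = R₀ ∨ ‖x‖ = R₁ := by
          by_contra! hne
          exact hA ⟨lt_of_le_of_ne hx.1 hne.1.symm, lt_of_le_of_ne hx.2 hne.2⟩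
        rw [hz10.2 x this]
    · obtain ⟨U, hU⟩ := hradial
      refine ⟨fun r θ => t * U r + (t * s) * 𝔳 r θ, ?_, ?_, ?_⟩
      · intro x hx
        rw [hz]
        try beta_reduce
        rw [hU x hx, hvax x hx]
      · intro r hr θ _
        simp only [h3 r hr θ]
      · intro r hr θ₁ hθ₁ θ₂ hθ₂ h12
        have := mul_le_mul_of_nonneg_left (h2 r hr hθ₁ hθ₂ h12) (mul_pos ht hs).le
        try beta_reduce
        linarith
    · by_contra! hall
      have hzero : E = 0 := by
        have hemp : annulus N R₀ R₁ = ∅ := by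
          ext x
          simp only [mem_empty_iff_false, iff_false]
          exact fun hx => (hzpos x hx).ne' (hall x hx)
        rw [hEp, hemp]
        simp
      exact hE0.ne' hzero
    · rw [hzH, hzP, htN]
  have hIz : funcI N R₀ R₁ (fun _ => 1) p z = (1 / 2 - 1 / p) * (t ^ 2 * (E + s ^ 2 * q)) := by
    unfold funcI
    rw [hzP, hzH, htN]
    ring
  have hIu : funcI N R₀ R₁ (fun _ => 1) p urad = (1 / 2 - 1 / p) * E := by
    unfold funcI
    have : ∫ x in annulus N R₀ R₁, (1 : ℝ) * |urad x| ^ p = E := by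
      rw [hEp]
      refine setIntegral_congr_fun hm fun x hx => ?_
      try beta_reduce
      rw [abs_of_pos (hpos x hx), one_mul]
    rw [this, ← hE]
    ring
  have hcoef : 0 < 1 / 2 - 1 / p := by
    rw [sub_pos]
    exact one_div_lt_one_div_of_lt two_pos hp
  have hlt : cI N R₀ R₁ (fun _ => 1) p < funcI N R₀ R₁ (fun _ => 1) p urad := by
    refine lt_of_le_of_lt (csInf_le ⟨0, ?_⟩ ⟨z, hzN, rfl⟩) ?_
    · rintro c ⟨y, hy, rfl⟩
      unfold funcI
      rw [← hy.2.2]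
      have := mul_nonneg hcoef.le (H1sq_nonneg (N := N) (R₀ := R₀) (R₁ := R₁) y)
      linarith
    · rw [hIz, hIu]
      exact mul_lt_mul_of_pos_left htE hcoef
  exact ⟨hlt, fun h => hlt.ne h.2.symm⟩
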